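/- For every real x ∈ (0,1), the series ∑_{s≥1} log( X_{s,s}(x)·X_{s-1,s-1}(x) / ( X_{s-1,s}(x)·X_{s,s-1}(x) ) ) converges and its sum equals log( (1−x^2)^2 / ((1−x)(1−x^3)) ). -/

import Mathlib

/-- `X_{s,t}(x)`. -/
noncomputable def Xfun (s t : ℕ) (x : ℝ) : ℝ :=
  ((1 - x ^ 3) * (1 - x ^ (s + 1)) * (1 - x ^ (t + 1)) * (1 - x ^ (s + t + 3))) /
    ((1 - x) * (1 - x ^ (s + 3)) * (1 - x ^ (t + 3)) * (1 - x ^ (s + t + 1)))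

/-- For `x ∈ (0,1)`, the series
`∑_{s≥1} log( X_{s,s}·X_{s−1,s−1} / (X_{s−1,s}·X_{s,s−1}) )` converges with sum
`log((1−x²)²/((1−x)(1−x³)))`.  (The index below is shifted: `s + 1` plays the role of `s ≥ 1`.) -/
theorem sum_log_Xfun (x : ℝ) (hx : x ∈ Set.Ioo (0:ℝ) 1) :
    HasSum
      (fun s : ℕ => Real.log
        (Xfun (s + 1) (s + 1) x * Xfun s s x / (Xfun s (s + 1) x * Xfun (s + 1) s x)))
      (Real.log ((1 - x ^ 2) ^ 2 / ((1 - x) * (1 - x ^ 3)))) := by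
  obtain ⟨h0, h1⟩ := hx
  have hq : ∀ n : ℕ, 0 < 1 - x ^ (n + 1) := fun n =>
    sub_pos.2 (pow_lt_one₀ h0.le h1 (Nat.succ_ne_zero n))
  have hratio : ∀ s : ℕ,
      Xfun (s + 1) (s + 1) x * Xfun s s x / (Xfun s (s + 1) x * Xfun (s + 1) s x)
        = ((1 - x ^ (2 * s + 5)) * (1 - x ^ (2 * s + 2)) ^ 2) /
          ((1 - x ^ (2 * s + 1)) * (1 - x ^ (2 * s + 4)) ^ 2) := by
    intro s
    unfold Xfun
    rw [show s + 1 + (s + 1) + 3 = 2 * s + 5 by ring, show s + 1 + (s + 1) + 1 = 2 * s + 3 by ring,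
      show s + (s + 1) + 3 = 2 * s + 4 by ring, show s + (s + 1) + 1 = 2 * s + 2 by ring,
      show s + 1 + s + 3 = 2 * s + 4 by ring, show s + 1 + s + 1 = 2 * s + 2 by ring,
      show s + s + 3 = 2 * s + 3 by ring, show s + s + 1 = 2 * s + 1 by ring,
      show s + 1 + 1 = s + 2 by ring, show s + 1 + 3 = s + 4 by ring]
    have a0 : 1 - x ≠ 0 := (sub_pos.2 h1).ne'
    have a1 := (hq 2).ne'
    have a2 := (hq s).ne'
    have a3 := (hq (s + 1)).ne'
    have a4 := (hq (s + 2)).ne'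
    have a5 := (hq (s + 3)).ne'
    have b1 := (hq (2 * s)).ne'
    have b2 := (hq (2 * s + 1)).ne'
    have b3 := (hq (2 * s + 2)).ne'
    have b4 := (hq (2 * s + 3)).ne'
    have b5 := (hq (2 * s + 4)).ne'
    simp only [add_assoc, Nat.reduceAdd] at a1 a2 a3 a4 a5 b1 b2 b3 b4 b5
    generalize 1 - x = c0 at *
    generalize 1 - x ^ 3 = c1 at *
    generalize 1 - x ^ (s + 1) = c2 at *
    generalize 1 - x ^ (s + 2) = c3 at *
    generalize 1 - x ^ (s + 3) = c4 at *
    generalize 1 - x ^ (s + 4) = c5 at *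
    generalize 1 - x ^ (2 * s + 1) = d1 at *
    generalize 1 - x ^ (2 * s + 2) = d2 at *
    generalize 1 - x ^ (2 * s + 3) = d3 at *
    generalize 1 - x ^ (2 * s + 4) = d4 at *
    generalize 1 - x ^ (2 * s + 5) = d5 at *
    field_simp
  simp only [hratio]
  set L : ℕ → ℝ := fun n => Real.log (1 - x ^ n) with hL
  set F : ℕ → ℝ := fun s => L (2 * s + 1) + L (2 * s + 3) - 2 * L (2 * s + 2) with hF
  have hterm : ∀ s : ℕ, Real.log (((1 - x ^ (2 * s + 5)) * (1 - x ^ (2 * s + 2)) ^ 2) /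
          ((1 - x ^ (2 * s + 1)) * (1 - x ^ (2 * s + 4)) ^ 2)) = F (s + 1) - F s := by
    intro s
    have b1 := (hq (2 * s)).ne'
    have b2 := (hq (2 * s + 1)).ne'
    have b4 := (hq (2 * s + 3)).ne'
    have b5 := (hq (2 * s + 4)).ne'
    rw [Real.log_div (mul_ne_zero b5 (pow_ne_zero _ b2)) (mul_ne_zero b1 (pow_ne_zero _ b4)),
      Real.log_mul b5 (pow_ne_zero _ b2), Real.log_mul b1 (pow_ne_zero _ b4),
      Real.log_pow, Real.log_pow]
    simp only [hF, hL, show 2 * (s + 1) + 1 = 2 * s + 3 by ring,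
      show 2 * (s + 1) + 3 = 2 * s + 5 by ring, show 2 * (s + 1) + 2 = 2 * s + 4 by ring]
    push_cast
    ring
  have hlim : ∀ k : ℕ, Filter.Tendsto (fun s : ℕ => L (2 * s + k)) Filter.atTop (nhds 0) := by
    intro k
    have hx0 : Filter.Tendsto (fun n : ℕ => L n) Filter.atTop (nhds 0) := by
      have h := ((tendsto_pow_atTop_nhds_zero_of_lt_one h0.le h1).const_sub 1).log (by norm_num)
      simpa using h
    refine hx0.comp (Filter.tendsto_atTop_mono (fun s => ?_) Filter.tendsto_id)
    simp only [id]
    omega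
  have hFlim : Filter.Tendsto F Filter.atTop (nhds 0) := by
    have h := ((hlim 1).add (hlim 3)).sub ((hlim 2).const_mul 2)
    simpa using h
  have hval : Real.log ((1 - x ^ 2) ^ 2 / ((1 - x) * (1 - x ^ 3))) = 0 - F 0 := by
    have a1 : 1 - x ≠ 0 := (sub_pos.2 h1).ne'
    have a2 : 1 - x ^ 2 ≠ 0 := (hq 1).ne'
    have a3 : 1 - x ^ 3 ≠ 0 := (hq 2).ne'
    rw [Real.log_div (pow_ne_zero _ a2) (mul_ne_zero a1 a3), Real.log_mul a1 a3, Real.log_pow]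
    simp only [hF, hL]
    norm_num
  rw [hval, hasSum_iff_tendsto_nat_of_nonneg]
  · simp only [hterm, Finset.sum_range_sub]
    exact hFlim.sub_const _
  · intro s
    apply Real.log_nonneg
    have b1 := hq (2 * s)
    have b4 := hq (2 * s + 3)
    rw [one_le_div (mul_pos b1 (pow_pos b4 2))]
    have hy : 0 < x ^ (2 * s + 1) := pow_pos h0 _
    rw [show x ^ (2 * s + 5) = x ^ (2 * s + 1) * x ^ 4 by ring,
      show x ^ (2 * s + 2) = x ^ (2 * s + 1) * x by ring,
      show x ^ (2 * s + 4) = x ^ (2 * s + 1) * x ^ 3 by ring]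
    generalize x ^ (2 * s + 1) = y at *
    have h1' : 0 < 1 - x := sub_pos.2 h1
    have : 0 ≤ y * (1 + x ^ 2 * y) * (1 - x) ^ 3 * (1 + x) := by positivity
    linarith
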